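/- Extrema of probabilistic choice: let 𝓘₁ and 𝓘₂ be nonempty sets of PMFs on T, let 0 ≤ p ≤ 1, and let f : T → ℝ be bounded on the supports of both 𝓘₁ and 𝓘₂. Define 𝓘₁ ⊕_p 𝓘₂ := { μ ⊕_p ν | μ ∈ 𝓘₁, ν ∈ 𝓘₂ }, where μ ⊕_p ν is the PMF with mass function x ↦ p * μ x + (1 − p) * ν x. Then Ex_min f (𝓘₁ ⊕_p 𝓘₂) = p * Ex_min f 𝓘₁ + (1 − p) * Ex_min f 𝓘₂, and Ex_max f (𝓘₁ ⊕_p 𝓘₂) = p * Ex_max f 𝓘₁ + (1 − p) * Ex_max f 𝓘₂. -/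

import Mathlib

open scoped ENNReal

/-- Expected value of `f` under the distribution `μ`: `∑' x, (μ x).toReal * f x`. -/
noncomputable def pexp {α : Type*} (μ : PMF α) (f : α → ℝ) : ℝ :=
  ∑' x, (μ x).toReal * f x

/-- The support of a nondeterministic probabilistic computation, modeled as a set
of PMFs: the union of the supports of its members. -/
def psupport {T : Type*} (I : Set (PMF T)) : Set T := ⋃ ν ∈ I, ν.support

/-- Minimal expected value of `f` over the set of distributions `I`. -/
noncomputable def exMin {T : Type*} (f : T → ℝ) (I : Set (PMF T)) : ℝ :=
  ⨅ ν : I, pexp ν.1 f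

/-- Maximal expected value of `f` over the set of distributions `I`. -/
noncomputable def exMax {T : Type*} (f : T → ℝ) (I : Set (PMF T)) : ℝ :=
  ⨆ ν : I, pexp ν.1 f

/-- Probabilistic choice between two PMFs: with probability `p` use `μ`, with
probability `1 - p` use `ν`; the mass function is `x ↦ p * μ x + (1 - p) * ν x`. -/
noncomputable def pchoice {α : Type*} (p : ℝ) (hp0 : 0 ≤ p) (hp1 : p ≤ 1)
    (μ ν : PMF α) : PMF α :=
  ⟨fun x => ENNReal.ofReal p * μ x + ENNReal.ofReal (1 - p) * ν x, by
    have h : HasSum (fun x => ENNReal.ofReal p * μ x + ENNReal.ofReal (1 - p) * ν x)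
        (∑' x, (ENNReal.ofReal p * μ x + ENNReal.ofReal (1 - p) * ν x)) :=
      ENNReal.summable.hasSum
    have hval : ∑' x, (ENNReal.ofReal p * μ x + ENNReal.ofReal (1 - p) * ν x) = 1 := by
      rw [ENNReal.tsum_add, ENNReal.tsum_mul_left, ENNReal.tsum_mul_left,
        μ.tsum_coe, ν.tsum_coe, mul_one, mul_one,
        ← ENNReal.ofReal_add hp0 (by linarith)]
      have hps : p + (1 - p) = 1 := by ring
      rw [hps, ENNReal.ofReal_one]
    exact hval ▸ h⟩

theorem PMF.summable_toReal {α : Type*} (μ : PMF α) : Summable fun x => (μ x).toReal :=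
  ENNReal.summable_toReal μ.tsum_coe_ne_top

theorem PMF.tsum_toReal {α : Type*} (μ : PMF α) : ∑' x, (μ x).toReal = 1 := by
  rw [← ENNReal.tsum_toReal_eq fun x => μ.apply_ne_top x, μ.tsum_coe, ENNReal.toReal_one]

theorem abs_toReal_mul_le {α : Type*} (μ : PMF α) {f : α → ℝ} {c : ℝ}
    (hf : ∀ x ∈ μ.support, |f x| ≤ c) (x : α) :
    |(μ x).toReal * f x| ≤ (μ x).toReal * c := by
  by_cases hx : μ x = 0
  · simp [hx]
  · rw [abs_mul, abs_of_nonneg ENNReal.toReal_nonneg]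
    exact mul_le_mul_of_nonneg_left (hf x ((μ.mem_support_iff x).2 hx)) ENNReal.toReal_nonneg

theorem summable_toReal_mul {α : Type*} (μ : PMF α) {f : α → ℝ} {c : ℝ}
    (hf : ∀ x ∈ μ.support, |f x| ≤ c) : Summable fun x => (μ x).toReal * f x :=
  (μ.summable_toReal.mul_right c).of_norm_bounded (abs_toReal_mul_le μ hf)

theorem abs_pexp_le {α : Type*} (μ : PMF α) {f : α → ℝ} {c : ℝ}
    (hf : ∀ x ∈ μ.support, |f x| ≤ c) : |pexp μ f| ≤ c := by
  have h : |pexp μ f| ≤ ∑' x, (μ x).toReal * c :=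
    tsum_of_norm_bounded (f := fun x => (μ x).toReal * f x) (μ.summable_toReal.mul_right c).hasSum
      (abs_toReal_mul_le μ hf)
  rwa [tsum_mul_right, μ.tsum_toReal, one_mul] at h

theorem pexp_pchoice {α : Type*} (p : ℝ) (hp0 : 0 ≤ p) (hp1 : p ≤ 1) (μ ν : PMF α)
    {f : α → ℝ} (hμ : Summable fun x => (μ x).toReal * f x)
    (hν : Summable fun x => (ν x).toReal * f x) :
    pexp (pchoice p hp0 hp1 μ ν) f = p * pexp μ f + (1 - p) * pexp ν f := by
  unfold pexp
  rw [← tsum_mul_left, ← tsum_mul_left, ← (hμ.mul_left p).tsum_add (hν.mul_left (1 - p))]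
  refine tsum_congr fun x => ?_
  have h : pchoice p hp0 hp1 μ ν x =
      ENNReal.ofReal p * μ x + ENNReal.ofReal (1 - p) * ν x := rfl
  rw [h, ENNReal.toReal_add (ENNReal.mul_ne_top ENNReal.ofReal_ne_top (μ.apply_ne_top x))
    (ENNReal.mul_ne_top ENNReal.ofReal_ne_top (ν.apply_ne_top x)), ENNReal.toReal_mul,
    ENNReal.toReal_mul, ENNReal.toReal_ofReal hp0, ENNReal.toReal_ofReal (sub_nonneg.2 hp1)]
  ring

theorem support_subset_psupport {T : Type*} {I : Set (PMF T)} {μ : PMF T} (hμ : μ ∈ I) :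
    μ.support ⊆ psupport I :=
  Set.subset_biUnion_of_mem (u := fun ν : PMF T => ν.support) hμ

theorem abs_pexp_le_of_mem {T : Type*} {I : Set (PMF T)} {f : T → ℝ} {c : ℝ}
    (hf : ∀ t ∈ psupport I, |f t| ≤ c) {μ : PMF T} (hμ : μ ∈ I) : |pexp μ f| ≤ c :=
  abs_pexp_le μ fun x hx => hf x (support_subset_psupport hμ hx)

theorem bddBelow_image_pexp {T : Type*} {I : Set (PMF T)} {f : T → ℝ} {c : ℝ}
    (hf : ∀ t ∈ psupport I, |f t| ≤ c) : BddBelow ((pexp · f) '' I) :=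
  ⟨-c, Set.forall_mem_image.2 fun _ hμ => (abs_le.1 (abs_pexp_le_of_mem hf hμ)).1⟩

theorem bddAbove_image_pexp {T : Type*} {I : Set (PMF T)} {f : T → ℝ} {c : ℝ}
    (hf : ∀ t ∈ psupport I, |f t| ≤ c) : BddAbove ((pexp · f) '' I) :=
  ⟨c, Set.forall_mem_image.2 fun _ hμ => (abs_le.1 (abs_pexp_le_of_mem hf hμ)).2⟩

theorem exMin_eq_sInf_image {T : Type*} (f : T → ℝ) (I : Set (PMF T)) :
    exMin f I = sInf ((pexp · f) '' I) :=
  (sInf_image' (f := (pexp · f))).symm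

theorem exMax_eq_sSup_image {T : Type*} (f : T → ℝ) (I : Set (PMF T)) :
    exMax f I = sSup ((pexp · f) '' I) :=
  (sSup_image' (f := (pexp · f))).symm

open scoped Pointwise in
theorem image_pexp_pchoice {T : Type*} {I₁ I₂ : Set (PMF T)}
    (p : ℝ) (hp0 : 0 ≤ p) (hp1 : p ≤ 1) {f : T → ℝ} {c₁ c₂ : ℝ}
    (hb₁ : ∀ t ∈ psupport I₁, |f t| ≤ c₁) (hb₂ : ∀ t ∈ psupport I₂, |f t| ≤ c₂) :
    (pexp · f) '' {ρ | ∃ μ ∈ I₁, ∃ ν ∈ I₂, ρ = pchoice p hp0 hp1 μ ν}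
      = p • ((pexp · f) '' I₁) + (1 - p) • ((pexp · f) '' I₂) := by
  have key : ∀ μ ∈ I₁, ∀ ν ∈ I₂,
      pexp (pchoice p hp0 hp1 μ ν) f = p * pexp μ f + (1 - p) * pexp ν f :=
    fun μ hμ ν hν => pexp_pchoice p hp0 hp1 μ ν
      (summable_toReal_mul μ fun x hx => hb₁ x (support_subset_psupport hμ hx))
      (summable_toReal_mul ν fun x hx => hb₂ x (support_subset_psupport hν hx))
  ext y
  constructor
  · rintro ⟨_, ⟨μ, hμ, ν, hν, rfl⟩, rfl⟩
    exact ⟨_, Set.smul_mem_smul_set ⟨μ, hμ, rfl⟩, _, Set.smul_mem_smul_set ⟨ν, hν, rfl⟩,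
      (key μ hμ ν hν).symm⟩
  · rintro ⟨_, ⟨_, ⟨μ, hμ, rfl⟩, rfl⟩, _, ⟨_, ⟨ν, hν, rfl⟩, rfl⟩, rfl⟩
    exact ⟨_, ⟨μ, hμ, ν, hν, rfl⟩, key μ hμ ν hν⟩

/-- Extrema of expected values of a probabilistic choice between two
nondeterministic probabilistic computations: the minimal (resp. maximal) expected
value of the `p`-choice is the `p`-convex combination of the minimal
(resp. maximal) expected values. -/
theorem exMin_exMax_pchoice {T : Type*} (I₁ I₂ : Set (PMF T))
    (h₁ : I₁.Nonempty) (h₂ : I₂.Nonempty)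
    (p : ℝ) (hp0 : 0 ≤ p) (hp1 : p ≤ 1)
    (f : T → ℝ) (c₁ c₂ : ℝ)
    (hb₁ : ∀ t ∈ psupport I₁, |f t| ≤ c₁) (hb₂ : ∀ t ∈ psupport I₂, |f t| ≤ c₂) :
    exMin f {ρ | ∃ μ ∈ I₁, ∃ ν ∈ I₂, ρ = pchoice p hp0 hp1 μ ν}
      = p * exMin f I₁ + (1 - p) * exMin f I₂ ∧
    exMax f {ρ | ∃ μ ∈ I₁, ∃ ν ∈ I₂, ρ = pchoice p hp0 hp1 μ ν}
      = p * exMax f I₁ + (1 - p) * exMax f I₂ := by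
  have hq : 0 ≤ 1 - p := sub_nonneg.2 hp1
  simp only [exMin_eq_sInf_image, exMax_eq_sSup_image, image_pexp_pchoice p hp0 hp1 hb₁ hb₂]
  constructor
  · rw [csInf_add (h₁.image _).smul_set ((bddBelow_image_pexp hb₁).smul_of_nonneg hp0)
      (h₂.image _).smul_set ((bddBelow_image_pexp hb₂).smul_of_nonneg hq),
      Real.sInf_smul_of_nonneg hp0, Real.sInf_smul_of_nonneg hq, smul_eq_mul, smul_eq_mul]
  · rw [csSup_add (h₁.image _).smul_set ((bddAbove_image_pexp hb₁).smul_of_nonneg hp0)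
      (h₂.image _).smul_set ((bddAbove_image_pexp hb₂).smul_of_nonneg hq),
      Real.sSup_smul_of_nonneg hp0, Real.sSup_smul_of_nonneg hq, smul_eq_mul, smul_eq_mul]
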